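/- arXiv:0704.3363 — 3 statements merged into one kernel-verified Lean document; each statement's English description precedes it below -/
import Mathlib

section
/- Let P ∈ ℂ[X_1,…,X_n] be a reduced (squarefree) polynomial with factorization P = P_1 ⋯ P_s into s distinct irreducible factors. For each j = 1,…,s define the n-tuple B^j = (B^j_1,…,B^j_n) by B^j_i = (∏_{k≠j} P_k)·(∂P_j/∂X_i). Then B^j belongs to F(P) for every j = 1,…,s. -/
open MvPolynomial

/-- The space `F(P)` for `P ∈ ℂ[X_1,…,X_n]`: tuples `A = (A_1,…,A_n)` with
`P·(∂A_j/∂X_i − ∂A_i/∂X_j) = A_j·(∂P/∂X_i) − A_i·(∂P/∂X_j)` for all `i < j`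
(closedness of the rational 1-form `ω(A) = Σ_i (A_i/P) dX_i`), subject to the
multidegree bounds `deg_{X_i} A_i ≤ m_i − 1` and `deg_{X_j} A_i ≤ m_j` for
`j ≠ i`, where `m_i = deg_{X_i} P`. -/
noncomputable def ruppertGaoSpace (n : ℕ) (P : MvPolynomial (Fin n) ℂ) :
    Submodule ℂ (Fin n → MvPolynomial (Fin n) ℂ) where
  carrier := { A | (∀ i j : Fin n, i < j →
        P * (pderiv i (A j) - pderiv j (A i)) = A j * pderiv i P - A i * pderiv j P) ∧
      (∀ i : Fin n, degreeOf i (A i) ≤ degreeOf i P - 1) ∧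
      (∀ i j : Fin n, j ≠ i → degreeOf j (A i) ≤ degreeOf j P) }
  add_mem' := by
    rintro A B ⟨h₁, d₁, d₂⟩ ⟨h₁', d₁', d₂'⟩
    refine ⟨fun i j hij => ?_, fun i => ?_, fun i j hij => ?_⟩
    · simp only [Pi.add_apply, map_add]
      linear_combination h₁ i j hij + h₁' i j hij
    · exact le_trans (MvPolynomial.degreeOf_add_le _ _ _) (max_le (d₁ i) (d₁' i))
    · exact le_trans (MvPolynomial.degreeOf_add_le _ _ _) (max_le (d₂ i j hij) (d₂' i j hij))
  zero_mem' :=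
    ⟨fun i j hij => by simp, fun i => by simp, fun i j hij => by simp⟩
  smul_mem' := by
    rintro c A ⟨h₁, d₁, d₂⟩
    refine ⟨fun i j hij => ?_, fun i => ?_, fun i j hij => ?_⟩
    · simp only [Pi.smul_apply, smul_eq_C_mul, pderiv_C_mul]
      linear_combination (C c : MvPolynomial (Fin n) ℂ) * h₁ i j hij
    · simpa [smul_eq_C_mul] using
        le_trans (MvPolynomial.degreeOf_C_mul_le (A i) i c) (d₁ i)
    · simpa [smul_eq_C_mul] using
        le_trans (MvPolynomial.degreeOf_C_mul_le (A i) j c) (d₂ i j hij)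

namespace MvPolynomial

variable {R σ : Type*} [CommSemiring R]

theorem add_single_mem_support_of_mem_support_pderiv {i : σ} {p : MvPolynomial σ R}
    {m : σ →₀ ℕ} (hm : m ∈ (pderiv i p).support) : m + Finsupp.single i 1 ∈ p.support := by
  rw [mem_support_iff, coeff_pderiv] at hm
  exact mem_support_iff.mpr (left_ne_zero_of_mul hm)

theorem degreeOf_pderiv_le (i j : σ) (p : MvPolynomial σ R) :
    degreeOf j (pderiv i p) ≤ degreeOf j p := by
  refine degreeOf_le_iff.mpr fun m hm => le_trans ?_
    (monomial_le_degreeOf j (add_single_mem_support_of_mem_support_pderiv hm))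
  simp

theorem degreeOf_pderiv_self_lt {i : σ} {p : MvPolynomial σ R} (hp : pderiv i p ≠ 0) :
    degreeOf i (pderiv i p) < degreeOf i p := by
  have succ_le : ∀ m ∈ (pderiv i p).support, m i + 1 ≤ degreeOf i p := fun m hm => by
    simpa using monomial_le_degreeOf i (add_single_mem_support_of_mem_support_pderiv hm)
  obtain ⟨m, hm⟩ := support_nonempty.mpr hp
  exact (degreeOf_lt_iff (Nat.zero_lt_of_lt (succ_le m hm))).mpr succ_le

theorem pderiv_pderiv_comm (i j : σ) (p : MvPolynomial σ R) :
    pderiv i (pderiv j p) = pderiv j (pderiv i p) := by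
  ext m
  obtain rfl | hij := eq_or_ne i j
  · rfl
  · simp only [coeff_pderiv, Finsupp.add_apply, Finsupp.single_eq_of_ne hij,
      Finsupp.single_eq_of_ne hij.symm, add_zero, add_right_comm m (Finsupp.single i 1)]
    exact mul_right_comm _ _ _

end MvPolynomial

/-- If `P = R * S` is nonzero, then `R • dS` lies in the space attached to `P`. -/
theorem mul_pderiv_mem_ruppertGaoSpace {n : ℕ} {R S : MvPolynomial (Fin n) ℂ}
    (hR : R ≠ 0) (hS : S ≠ 0) :
    (fun i => R * pderiv i S) ∈ ruppertGaoSpace n (R * S) := by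
  refine ⟨fun i j _ => ?_, fun i => ?_, fun i j _ => ?_⟩
  · simp only [pderiv_mul]
    linear_combination R * S * R * pderiv_pderiv_comm i j S
  · by_cases h : pderiv i S = 0
    · simp [h]
    · have hmul := degreeOf_mul_le i R (pderiv i S)
      have hlt := degreeOf_pderiv_self_lt h
      rw [degreeOf_mul_eq hR hS]
      lia
  · rw [degreeOf_mul_eq hR hS]
    exact (degreeOf_mul_le j R _).trans (Nat.add_le_add_left (degreeOf_pderiv_le i j S) _)

/-- for a reduced (squarefree) polynomial `P = P_1 ⋯ P_s` in
`ℂ[X_1,…,X_n]` with `s` distinct irreducible factors, each tuple `B^j` given by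
`B^j_i = (∏_{k≠j} P_k)·∂P_j/∂X_i` belongs to `F(P)`. -/
theorem B_mem_ruppertGaoSpace
    (n : ℕ) (P : MvPolynomial (Fin n) ℂ) (s : ℕ) (Q : Fin s → MvPolynomial (Fin n) ℂ)
    (hfac : P = ∏ i, Q i) (hirr : ∀ i, Irreducible (Q i))
    (hdist : ∀ i j, i ≠ j → ¬ Associated (Q i) (Q j))
    (B : Fin s → Fin n → MvPolynomial (Fin n) ℂ)
    (hB : ∀ j i, B j i = (∏ k ∈ Finset.univ.erase j, Q k) * pderiv i (Q j)) :
    ∀ j, B j ∈ ruppertGaoSpace n P := by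
  intro j
  have hP : P = (∏ k ∈ Finset.univ.erase j, Q k) * Q j := by
    rw [hfac, Finset.prod_erase_mul _ _ (Finset.mem_univ j)]
  rw [hP, funext (hB j)]
  exact mul_pderiv_mem_ruppertGaoSpace
    (Finset.prod_ne_zero_iff.mpr fun k _ => (hirr k).ne_zero) (hirr j).ne_zero
end

section
/- Let P ∈ ℂ[X_1,…,X_n] be a reduced (squarefree) polynomial which is X_1-generic, with factorization P = P_1 ⋯ P_s into distinct irreducible factors. For j = 1,…,s set B^j_1 = (∏_{k≠j} P_k)·(∂P_j/∂X_1). Then the residue classes [B^1_1],…,[B^s_1] in the quotient ring Q(P) = ℂ[X_1,…,X_n]/(P) are linearly independent over ℂ. -/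
open MvPolynomial

/-- A polynomial `P ∈ ℂ[X_1,…,X_{n+1}]` (variable `0` playing the role of `X_1`)
is `X_1`-generic if the projection forgetting the first coordinate, restricted to
the hypersurface `V(P)`, has finite fibers: for every `b ∈ ℂⁿ` the set
`{t ∈ ℂ : P(t, b) = 0}` is finite. -/
def IsX1Generic (n : ℕ) (P : MvPolynomial (Fin (n + 1)) ℂ) : Prop :=
  ∀ b : Fin n → ℂ, {t : ℂ | eval (Fin.cons t b) P = 0}.Finite


namespace MvPolynomial

/-- `finSuccEquiv` turns the partial derivative in the variable `0` into the formal derivative. -/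
theorem finSuccEquiv_pderiv_zero {R : Type*} [CommRing R] {n : ℕ}
    (f : MvPolynomial (Fin (n + 1)) R) :
    finSuccEquiv R n (pderiv 0 f) = Polynomial.derivative (finSuccEquiv R n f) := by
  induction f using MvPolynomial.induction_on with
  | C a => simp [finSuccEquiv_apply]
  | add p q hp hq => simp [hp, hq]
  | mul_X p i hp =>
    rw [pderiv_mul, map_add, map_mul, map_mul, hp, map_mul, Polynomial.derivative_mul]
    cases i using Fin.cases with
    | zero => simp [finSuccEquiv_X_zero]
    | succ j => simp [finSuccEquiv_X_succ]

/-- In characteristic zero a polynomial dividing its derivative in the variable `0` has constant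
values along the direction of that variable. -/
theorem eval_cons_eq_of_dvd_pderiv {R : Type*} [CommRing R] [IsDomain R] [CharZero R] {n : ℕ}
    {f : MvPolynomial (Fin (n + 1)) R} (h : f ∣ pderiv 0 f) (b : Fin n → R) (t u : R) :
    eval (Fin.cons t b) f = eval (Fin.cons u b) f := by
  have hdvd := map_dvd (finSuccEquiv R n) h
  rw [finSuccEquiv_pderiv_zero, Polynomial.dvd_derivative_iff] at hdvd
  have hC := Polynomial.eq_C_of_derivative_eq_zero hdvd
  rw [eval_eq_eval_mv_eval', eval_eq_eval_mv_eval', hC]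
  simp

/-- A non-unit polynomial over an algebraically closed field has a zero. -/
theorem exists_eval_eq_zero_of_not_isUnit {K σ : Type*} [Field K] [IsAlgClosed K] [Finite σ]
    {f : MvPolynomial σ K} (hf : ¬ IsUnit f) : ∃ x : σ → K, eval x f = 0 := by
  obtain ⟨I, hI, hfI⟩ := exists_max_ideal_of_mem_nonunits hf
  obtain ⟨x, rfl⟩ := eq_vanishingIdeal_singleton_of_isMaximal K hI
  exact ⟨x, by simpa [aeval_eq_eval] using hfI⟩

end MvPolynomial

/-- A non-unit factor of an `X_1`-generic polynomial does not divide its own derivative with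
respect to `X_1`. -/
theorem IsX1Generic.not_dvd_pderiv {n : ℕ} {P f : MvPolynomial (Fin (n + 1)) ℂ}
    (hP : IsX1Generic n P) (hfP : f ∣ P) (hf : ¬ IsUnit f) : ¬ f ∣ pderiv 0 f := by
  intro h
  obtain ⟨x, hx⟩ := exists_eval_eq_zero_of_not_isUnit hf
  refine Set.infinite_univ ((hP (Fin.tail x)).subset fun t _ => ?_)
  obtain ⟨g, rfl⟩ := hfP
  have ht : eval (Fin.cons t (Fin.tail x)) f = 0 := by
    rw [eval_cons_eq_of_dvd_pderiv h (Fin.tail x) t (x 0), Fin.cons_self_tail, hx]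
  simp [ht]

/-- for a reduced (squarefree) `X_1`-generic polynomial
`P = P_1 ⋯ P_s ∈ ℂ[X_1,…,X_{n+1}]` with distinct irreducible factors, the
residue classes of `B^j_1 = (∏_{k≠j} P_k)·∂P_j/∂X_1` in
`Q(P) = ℂ[X_1,…,X_{n+1}]/(P)` are linearly independent over `ℂ`. -/
theorem linearIndependent_B_classes
    (n : ℕ) (P : MvPolynomial (Fin (n + 1)) ℂ) (s : ℕ)
    (Q : Fin s → MvPolynomial (Fin (n + 1)) ℂ)
    (hfac : P = ∏ i, Q i) (hirr : ∀ i, Irreducible (Q i))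
    (hdist : ∀ i j, i ≠ j → ¬ Associated (Q i) (Q j))
    (hgen : IsX1Generic n P)
    (B : Fin s → MvPolynomial (Fin (n + 1)) ℂ)
    (hB : ∀ j, B j = (∏ k ∈ Finset.univ.erase j, Q k) * pderiv 0 (Q j)) :
    LinearIndependent ℂ (fun j => Ideal.Quotient.mk (Ideal.span {P}) (B j)) := by
  rw [Fintype.linearIndependent_iff]
  intro c hc i
  by_contra hci
  have hQP : Q i ∣ P := hfac ▸ Finset.dvd_prod_of_mem Q (Finset.mem_univ i)
  have hsum : Q i ∣ ∑ j, c j • B j := by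
    refine hQP.trans (Ideal.mem_span_singleton.mp (Ideal.Quotient.eq_zero_iff_mem.mp ?_))
    rw [map_sum, ← hc]
    exact Finset.sum_congr rfl fun j _ => rfl
  have hother : Q i ∣ ∑ j ∈ Finset.univ.erase i, c j • B j := by
    refine Finset.dvd_sum fun j hj => ?_
    rw [smul_eq_C_mul, hB]
    exact ((Finset.dvd_prod_of_mem Q (Finset.mem_erase.mpr
      ⟨(Finset.ne_of_mem_erase hj).symm, Finset.mem_univ i⟩)).mul_right _).mul_left _
  rw [← Finset.add_sum_erase _ _ (Finset.mem_univ i), dvd_add_left hother, smul_eq_C_mul,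
    (isUnit_iff_ne_zero.mpr hci |>.map (C (σ := Fin (n + 1)))).dvd_mul_left, hB] at hsum
  rcases (hirr i).prime.dvd_or_dvd hsum with hprod | hderiv
  · obtain ⟨k, hk, hdvd⟩ := (hirr i).prime.exists_mem_finset_dvd hprod
    exact hdist i k (Finset.ne_of_mem_erase hk).symm ((hirr i).associated_of_dvd (hirr k) hdvd)
  · exact hgen.not_dvd_pderiv hQP (hirr i).not_isUnit hderiv
end

section
/- Let P ∈ ℂ[X_1,…,X_n] be a reduced (squarefree) polynomial which is X_1-generic, with factorization P = P_1 ⋯ P_s into distinct irreducible factors. For j = 1,…,s set B^j_1 = (∏_{k≠j} P_k)·(∂P_j/∂X_1) and C^j_1 = B^j_1·(∂P/∂X_1). Then the residue classes [C^1_1],…,[C^s_1] in the quotient ring Q(P) = ℂ[X_1,…,X_n]/(P) are linearly independent over ℂ; in particular, the subspace Ẽ(P) of Q(P) spanned by the classes [v·(∂P/∂X_1)] for v ∈ E(P) has dimension s. -/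
open MvPolynomial

theorem MvPolynomial.coeff_X_mul_pderiv {σ R : Type*} [CommSemiring R] (i : σ)
    (f : MvPolynomial σ R) (m : σ →₀ ℕ) :
    coeff m (X i * pderiv i f) = m i * coeff m f := by
  classical
  induction f using MvPolynomial.induction_on' with
  | monomial u a =>
    rw [X_mul_pderiv_monomial, coeff_smul, coeff_monomial, nsmul_eq_mul]
    split_ifs with h <;> simp [h]
  | add p q hp hq => simp only [map_add, mul_add, coeff_add, hp, hq]

/-- Two polynomials whose logarithmic derivatives agree are proportional. -/
theorem MvPolynomial.exists_eq_C_mul_of_mul_pderiv_eq {n : ℕ} {f g : MvPolynomial (Fin n) ℂ}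
    (hf : f ≠ 0) (h : ∀ i, f * pderiv i g = g * pderiv i f) : ∃ c : ℂ, g = C c * f := by
  let m : MonomialOrder (Fin n) := MonomialOrder.lex
  have hlc : coeff (m.degree f) f ≠ 0 := m.coeff_degree_ne_zero_iff.mpr hf
  set c := coeff (m.degree f) g / coeff (m.degree f) f with hc
  refine ⟨c, ?_⟩
  by_contra hne
  set k := g - C c * f with hk
  have hk0 : k ≠ 0 := sub_ne_zero.mpr hne
  have hkc : coeff (m.degree f) k = 0 := by
    rw [hk, coeff_sub, coeff_C_mul, hc, div_mul_cancel₀ _ hlc, sub_self]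
  have hlk : coeff (m.degree k) k ≠ 0 := m.coeff_degree_ne_zero_iff.mpr hk0
  refine hlk ?_
  suffices hdeg : m.degree k = m.degree f by rw [hdeg, hkc]
  have hle (u : MvPolynomial (Fin n) ℂ) (i : Fin n) :
      m.toSyn (m.degree (X i * pderiv i u)) ≤ m.toSyn (m.degree u) := by
    rw [m.degree_le_iff]
    intro b hb
    refine m.le_degree ?_
    rw [mem_support_iff, coeff_X_mul_pderiv] at hb
    exact mem_support_iff.mpr (right_ne_zero_of_mul hb)
  ext i
  have hi : f * (X i * pderiv i k) = (X i * pderiv i f) * k := by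
    rw [hk, map_sub, pderiv_C_mul]
    linear_combination X i * h i
  have hco := congrArg (coeff (m.degree f + m.degree k)) hi
  rw [m.coeff_mul_of_add_of_degree_le le_rfl (hle k i),
    m.coeff_mul_of_add_of_degree_le (hle f i) le_rfl, coeff_X_mul_pderiv,
    coeff_X_mul_pderiv] at hco
  have : ((m.degree k i : ℂ) - m.degree f i) * (coeff (m.degree f) f * coeff (m.degree k) k) = 0 := by
    linear_combination hco
  have := (mul_eq_zero.mp this).resolve_right (mul_ne_zero hlc hlk)
  exact_mod_cast sub_eq_zero.mp this

theorem MvPolynomial.pderiv_comm {σ R : Type*} [CommSemiring R] (i j : σ)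
    (f : MvPolynomial σ R) : pderiv i (pderiv j f) = pderiv j (pderiv i f) := by
  classical
  rcases eq_or_ne i j with rfl | hij
  · rfl
  · ext m
    simp only [coeff_pderiv, Finsupp.add_apply, Finsupp.single_eq_of_ne hij,
      Finsupp.single_eq_of_ne hij.symm, add_zero]
    rw [add_right_comm]
    ring

theorem MvPolynomial.degreeOf_pderiv_le_s11 {σ R : Type*} [CommSemiring R] (i j : σ)
    (f : MvPolynomial σ R) : degreeOf j (pderiv i f) ≤ degreeOf j f := by
  classical
  rw [degreeOf_le_iff]
  intro m hm
  rw [mem_support_iff, coeff_pderiv] at hm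
  have := monomial_le_degreeOf j (mem_support_iff.mpr (left_ne_zero_of_mul hm))
  simp only [Finsupp.add_apply] at this
  omega

theorem MvPolynomial.degreeOf_pderiv_self_le {σ R : Type*} [CommSemiring R] (i : σ)
    (f : MvPolynomial σ R) : degreeOf i (pderiv i f) ≤ degreeOf i f - 1 := by
  classical
  rw [degreeOf_le_iff]
  intro m hm
  rw [mem_support_iff, coeff_pderiv] at hm
  have := monomial_le_degreeOf i (mem_support_iff.mpr (left_ne_zero_of_mul hm))
  simp only [Finsupp.add_apply, Finsupp.single_eq_same] at this
  omega

theorem MvPolynomial.pderiv_eq_zero_of_degreeOf_eq_zero {σ R : Type*} [CommSemiring R] {i : σ}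
    {f : MvPolynomial σ R} (h : degreeOf i f = 0) : pderiv i f = 0 := by
  ext m
  rw [coeff_pderiv, coeff_zero]
  by_contra hm
  have := monomial_le_degreeOf i (mem_support_iff.mpr (left_ne_zero_of_mul hm))
  simp [h] at this

theorem MvPolynomial.not_dvd_pderiv_zero {n : ℕ} {q : MvPolynomial (Fin (n + 1)) ℂ}
    (h : degreeOf 0 q ≠ 0) : ¬ q ∣ pderiv 0 q := by
  rintro ⟨r, hr⟩
  have hq : q ≠ 0 := by rintro rfl; simp at h
  have hle := degreeOf_pderiv_self_le 0 q
  by_cases hr0 : r = 0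
  · obtain ⟨m, hm, hmd⟩ : ∃ m ∈ q.support, m 0 ≠ 0 := by
      by_contra! hall
      exact h (Nat.le_zero.mp (degreeOf_le_iff.mpr fun m hm => (hall m hm).le))
    have := coeff_X_mul_pderiv 0 q m
    rw [hr, hr0, mul_zero, mul_zero, coeff_zero] at this
    exact mul_ne_zero (Nat.cast_ne_zero.mpr hmd) (mem_support_iff.mp hm) this.symm
  · rw [hr, degreeOf_mul_eq hq hr0] at hle
    omega

theorem IsX1Generic.degreeOf_ne_zero {n : ℕ} {P q : MvPolynomial (Fin (n + 1)) ℂ}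
    (hP : IsX1Generic n P) (hq : ¬ IsUnit q) (hqP : q ∣ P) :
    degreeOf 0 q ≠ 0 := by
  intro h0
  rw [← natDegree_finSuccEquiv] at h0
  obtain ⟨M, hM, hle⟩ := Ideal.exists_le_maximal _ (mt Ideal.span_singleton_eq_top.mp hq)
  obtain ⟨x, rfl⟩ := eq_vanishingIdeal_singleton_of_isMaximal ℂ hM
  have hx : aeval x q = 0 := (mem_vanishingIdeal_singleton_iff x q).mp
    (hle (Ideal.mem_span_singleton_self q))
  refine Set.infinite_univ.mono (fun t _ => ?_) (hP (Fin.tail x))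
  suffices ht : eval (Fin.cons t (Fin.tail x)) q = 0 from
    zero_dvd_iff.mp (ht ▸ map_dvd (eval (Fin.cons t (Fin.tail x))) hqP)
  rw [← Fin.cons_self_tail x] at hx
  change eval _ q = 0 at hx
  rw [eval_eq_eval_mv_eval', Polynomial.eq_C_of_natDegree_eq_zero h0] at hx ⊢
  simpa using hx

theorem dvd_mul_derivation_pow_mul_pow_sub {R A : Type*} [CommRing R] [CommRing A] [Algebra R A]
    (D : Derivation R A A) {q a p : A} (h : q ∣ p * D a - a * D p) (k l : ℕ) :
    q ∣ p * D (a ^ k * p ^ l) - ((k + l : ℕ) : A) * (a ^ k * p ^ l) * D p := by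
  induction k with
  | zero =>
    induction l with
    | zero => simp
    | succ l ih =>
      obtain ⟨r, hr⟩ := ih
      refine ⟨p * r, ?_⟩
      simp only [pow_succ, Derivation.leibniz, smul_eq_mul, pow_zero, one_mul] at hr ⊢
      push_cast at hr ⊢
      linear_combination p * hr
  | succ k ih =>
    obtain ⟨r, hr⟩ := ih
    obtain ⟨t, ht⟩ := h
    refine ⟨a * r + a ^ k * p ^ l * t, ?_⟩
    rw [pow_succ', mul_assoc, D.leibniz]
    simp only [smul_eq_mul]
    push_cast at hr ⊢
    linear_combination a * hr + a ^ k * p ^ l * ht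

theorem MvPolynomial.aeval_finSuccEquiv {n : ℕ} {L : Type*} [CommRing L]
    [Algebra (MvPolynomial (Fin n) ℂ) L] (φ : MvPolynomial (Fin (n + 1)) ℂ →+* L)
    (hφ : ∀ f, algebraMap (MvPolynomial (Fin n) ℂ) L f = φ (rename Fin.succ f))
    (f : MvPolynomial (Fin (n + 1)) ℂ) :
    Polynomial.aeval (φ (X 0)) (finSuccEquiv ℂ n f) = φ f := by
  induction f using MvPolynomial.induction_on with
  | C c => simp [finSuccEquiv_apply, hφ]
  | add f g hf hg => simp only [map_add, hf, hg]
  | mul_X f i hf =>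
    suffices hi : Polynomial.aeval (φ (X 0)) (finSuccEquiv ℂ n (X i)) = φ (X i) by
      rw [map_mul, map_mul, map_mul, hf, hi]
    cases i using Fin.cases with
    | zero => simp [finSuccEquiv_X_zero]
    | succ i => simp [finSuccEquiv_X_succ, hφ]

theorem MvPolynomial.isAlgebraic_of_map_eq_zero {n : ℕ} {L : Type*} [Field L]
    [Algebra (MvPolynomial (Fin n) ℂ) L] (φ : MvPolynomial (Fin (n + 1)) ℂ →+* L)
    (hφ : ∀ f, algebraMap (MvPolynomial (Fin n) ℂ) L f = φ (rename Fin.succ f))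
    {q : MvPolynomial (Fin (n + 1)) ℂ} (hq : q ≠ 0) (hφq : φ q = 0)
    (f : MvPolynomial (Fin (n + 1)) ℂ) : IsAlgebraic (MvPolynomial (Fin n) ℂ) (φ f) := by
  induction f using MvPolynomial.induction_on with
  | C c => simpa [hφ] using isAlgebraic_algebraMap (A := L) (C c : MvPolynomial (Fin n) ℂ)
  | add f g hf hg => simpa using hf.add hg
  | mul_X f i hf =>
    rw [map_mul]
    refine hf.mul ?_
    cases i using Fin.cases with
    | zero =>
      exact ⟨finSuccEquiv ℂ n q, by simpa using hq, by rw [aeval_finSuccEquiv φ hφ, hφq]⟩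
    | succ i => simpa [hφ] using isAlgebraic_algebraMap (A := L) (X i : MvPolynomial (Fin n) ℂ)

theorem sum_homogenized_eq {n : ℕ} {L : Type*} [Field L]
    [Algebra (MvPolynomial (Fin n) ℂ) L] (φ : MvPolynomial (Fin (n + 1)) ℂ →+* L)
    (hφ : ∀ f, algebraMap (MvPolynomial (Fin n) ℂ) L f = φ (rename Fin.succ f))
    {a p : MvPolynomial (Fin (n + 1)) ℂ} (hp : φ p ≠ 0) {d : ℕ}
    {f : Polynomial (MvPolynomial (Fin n) ℂ)} (hf : f.natDegree ≤ d) :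
    φ (∑ k ∈ Finset.range (d + 1), rename Fin.succ (f.coeff k) * (a ^ k * p ^ (d - k))) =
      φ p ^ d * Polynomial.aeval (φ a / φ p) f := by
  rw [Polynomial.aeval_eq_sum_range' (Nat.lt_succ_of_le hf), map_sum, Finset.mul_sum]
  refine Finset.sum_congr rfl fun k hk => ?_
  have hk : k ≤ d := by simpa [Nat.lt_succ_iff] using hk
  rw [Algebra.smul_def, hφ, map_mul, map_mul, map_pow, map_pow, div_pow,
    ← Nat.sub_add_cancel hk, pow_add, Nat.sub_add_cancel hk]
  field_simp

theorem dvd_sum_homogenized_pderiv {n : ℕ} {q a p : MvPolynomial (Fin (n + 1)) ℂ} (hq : Prime q)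
    (hp : ¬ q ∣ p) (i : Fin n)
    (D : Derivation ℂ (MvPolynomial (Fin (n + 1)) ℂ) (MvPolynomial (Fin (n + 1)) ℂ))
    (hDq : q ∣ D q) (hD : ∀ f, D (rename Fin.succ f) = p * rename Fin.succ (pderiv i f))
    (hDa : q ∣ p * D a - a * D p) (d : ℕ) (u : ℕ → MvPolynomial (Fin n) ℂ)
    (hu : q ∣ ∑ k ∈ Finset.range (d + 1), rename Fin.succ (u k) * (a ^ k * p ^ (d - k))) :
    q ∣ ∑ k ∈ Finset.range (d + 1), rename Fin.succ (pderiv i (u k)) * (a ^ k * p ^ (d - k)) := by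
  set N := ∑ k ∈ Finset.range (d + 1), rename Fin.succ (u k) * (a ^ k * p ^ (d - k)) with hN
  set M := ∑ k ∈ Finset.range (d + 1),
    rename Fin.succ (pderiv i (u k)) * (a ^ k * p ^ (d - k)) with hM
  have hDN : q ∣ D N := by
    obtain ⟨r, hr⟩ := hu
    rw [hr, D.leibniz]
    exact dvd_add (Dvd.intro _ rfl) (hDq.mul_left r)
  have key : q ∣ p * D N - (p * p * M + (d : MvPolynomial (Fin (n + 1)) ℂ) * N * D p) := by
    rw [hN, hM, map_sum, Finset.mul_sum, Finset.mul_sum, Finset.mul_sum, Finset.sum_mul,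
      ← Finset.sum_add_distrib, ← Finset.sum_sub_distrib]
    refine Finset.dvd_sum fun k hk => ?_
    have hk : k ≤ d := by simpa [Nat.lt_succ_iff] using hk
    obtain ⟨r, hr⟩ := dvd_mul_derivation_pow_mul_pow_sub D hDa k (d - k)
    rw [Nat.add_sub_cancel' hk] at hr
    refine ⟨rename Fin.succ (u k) * r, ?_⟩
    rw [D.leibniz, hD]
    simp only [smul_eq_mul]
    linear_combination rename Fin.succ (u k) * hr
  have hpM : q ∣ p * p * M := by
    have := (hDN.mul_left p).sub key
    have h2 := this.sub ((hu.mul_left (d : MvPolynomial (Fin (n + 1)) ℂ)).mul_right (D p))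
    convert h2 using 1
    ring
  exact (hq.dvd_or_dvd hpM).resolve_left fun h => hp ((hq.dvd_or_dvd h).elim id id)

/-- An element `a / p` of the function field of the hypersurface `q = 0` which is killed by
derivations extending the partial derivatives `∂/∂X_i`, `i ≥ 2`, is a constant. -/
theorem exists_dvd_sub_C_mul_of_derivation {n : ℕ} {q a p : MvPolynomial (Fin (n + 1)) ℂ}
    (hq : Prime q) (hdeg : degreeOf 0 q ≠ 0) (hp : ¬ q ∣ p)
    (D : Fin n → Derivation ℂ (MvPolynomial (Fin (n + 1)) ℂ) (MvPolynomial (Fin (n + 1)) ℂ))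
    (hDq : ∀ i, q ∣ D i q)
    (hD : ∀ i f, D i (rename Fin.succ f) = p * rename Fin.succ (pderiv i f))
    (hDa : ∀ i, q ∣ p * D i a - a * D i p) : ∃ c : ℂ, q ∣ a - C c * p := by
  classical
  have : (Ideal.span {q}).IsPrime := (Ideal.span_singleton_prime hq.ne_zero).mpr hq
  let A := MvPolynomial (Fin (n + 1)) ℂ ⧸ Ideal.span {q}
  let L := FractionRing A
  let φ : MvPolynomial (Fin (n + 1)) ℂ →+* L :=
    (algebraMap A L).comp (Ideal.Quotient.mk (Ideal.span {q}))
  have hφ0 (f) : φ f = 0 ↔ q ∣ f := by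
    rw [RingHom.comp_apply, FaithfulSMul.algebraMap_eq_zero_iff,
      Ideal.Quotient.eq_zero_iff_mem, Ideal.mem_span_singleton]
  have hφp : φ p ≠ 0 := mt (hφ0 p).mp hp
  let _ : Algebra (MvPolynomial (Fin n) ℂ) L :=
    (φ.comp (rename Fin.succ : MvPolynomial (Fin n) ℂ →ₐ[ℂ] _).toRingHom).toAlgebra
  have hφ (f) : algebraMap (MvPolynomial (Fin n) ℂ) L f = φ (rename Fin.succ f) := rfl
  have hinj (f : MvPolynomial (Fin n) ℂ) (hf : f ≠ 0) : φ (rename Fin.succ f) ≠ 0 := by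
    rw [Ne, hφ0]
    rintro ⟨r, hr⟩
    have hne : rename (Fin.succ : Fin n → Fin (n + 1)) f ≠ 0 :=
      (map_ne_zero_iff _ (rename_injective _ (Fin.succ_injective n))).mpr hf
    have hr0 : r ≠ 0 := by rintro rfl; exact hne (by simpa using hr)
    have h0 : degreeOf 0 (rename (Fin.succ : Fin n → Fin (n + 1)) f) = 0 := by
      refine Nat.le_zero.mp (degreeOf_le_iff.mpr fun m hm => ?_)
      refine (mem_support_notMem_vars_zero hm fun h0 => ?_).le
      simpa using vars_rename _ _ h0
    rw [hr, degreeOf_mul_eq hq.ne_zero hr0] at h0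
    omega
  set ρ : L := φ a / φ p with hρ
  have halg : IsAlgebraic (MvPolynomial (Fin n) ℂ) ρ := by
    have h := isAlgebraic_of_map_eq_zero φ hφ hq.ne_zero ((hφ0 q).mpr dvd_rfl)
    rw [hρ, div_eq_mul_inv]
    exact (h a).mul (IsAlgebraic.inv_iff.mpr (h p))
  obtain ⟨f, ⟨hf0, hfρ⟩, hmin⟩ := exists_minimalFor_of_wellFoundedLT
    (fun f : Polynomial (MvPolynomial (Fin n) ℂ) => f ≠ 0 ∧ Polynomial.aeval ρ f = 0)
    Polynomial.degree halg
  set d := f.natDegree with hd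
  have hlead : f.coeff d ≠ 0 := Polynomial.leadingCoeff_ne_zero.mpr hf0
  have hcoeff (k : ℕ) (i : Fin n) :
      f.coeff d * pderiv i (f.coeff k) = f.coeff k * pderiv i (f.coeff d) := by
    let g : Polynomial (MvPolynomial (Fin n) ℂ) := ∑ k ∈ Finset.range (d + 1),
      Polynomial.monomial k (f.coeff d * pderiv i (f.coeff k) - pderiv i (f.coeff d) * f.coeff k)
    have hg (k : ℕ) : g.coeff k =
        f.coeff d * pderiv i (f.coeff k) - pderiv i (f.coeff d) * f.coeff k := by
      simp only [g, Polynomial.finsetSum_coeff, Polynomial.coeff_monomial, Finset.sum_ite_eq',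
        Finset.mem_range]
      split_ifs with hk
      · rfl
      · rw [Polynomial.coeff_eq_zero_of_natDegree_lt (by omega : f.natDegree < k)]
        simp
    have hgdeg : g.degree < f.degree := by
      rw [Polynomial.degree_eq_natDegree hf0, Polynomial.degree_lt_iff_coeff_zero]
      intro k hk
      rw [hg]
      rcases hk.eq_or_lt with rfl | hk
      · ring
      · rw [Polynomial.coeff_eq_zero_of_natDegree_lt hk]
        simp
    have hN := sum_homogenized_eq φ hφ (a := a) hφp (le_refl d)
    rw [hfρ, mul_zero, hφ0] at hN
    have hM := dvd_sum_homogenized_pderiv hq hp i (D i) (hDq i) (hD i) (hDa i) d f.coeff hN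
    have hgρ : Polynomial.aeval ρ g = 0 := by
      have hgN := sum_homogenized_eq φ hφ (a := a) hφp
        (Polynomial.natDegree_le_natDegree hgdeg.le : g.natDegree ≤ d)
      rw [(hφ0 _).mpr] at hgN
      · exact (mul_eq_zero.mp hgN.symm).resolve_left (pow_ne_zero _ hφp)
      · convert (hM.mul_left (rename Fin.succ (f.coeff d))).sub
          (hN.mul_left (rename Fin.succ (pderiv i (f.coeff d)))) using 1
        rw [Finset.mul_sum, Finset.mul_sum, ← Finset.sum_sub_distrib]
        refine Finset.sum_congr rfl fun k _ => ?_
        rw [hg, map_sub, map_mul, map_mul]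
        ring
    have hg0 : g = 0 := by
      by_contra hg0
      exact (hmin ⟨hg0, hgρ⟩ hgdeg.le).not_gt hgdeg
    have := hg k
    rw [hg0, Polynomial.coeff_zero] at this
    linear_combination -this
  choose c hc using fun k => exists_eq_C_mul_of_mul_pderiv_eq hlead (hcoeff k)
  let _ : Algebra ℂ L := (φ.comp C).toAlgebra
  have hρℂ : IsAlgebraic ℂ ρ := by
    refine ⟨∑ k ∈ Finset.range (d + 1), Polynomial.monomial k (c k), fun h0 => ?_, ?_⟩
    · have hcd := congrArg (Polynomial.coeff · d) h0
      simp only [Polynomial.finsetSum_coeff, Polynomial.coeff_monomial, Finset.sum_ite_eq',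
        Finset.mem_range, lt_add_one, if_true, Polynomial.coeff_zero] at hcd
      apply hlead
      rw [hc d, hcd, C_0, zero_mul]
    · refine (mul_eq_zero.mp (Eq.trans ?_ hfρ)).resolve_left (hinj _ hlead)
      rw [Polynomial.aeval_eq_sum_range (p := f), map_sum, Finset.mul_sum]
      refine Finset.sum_congr rfl fun k _ => ?_
      rw [Algebra.smul_def, hφ, hc k, Polynomial.aeval_monomial, map_mul, map_mul, rename_C]
      change _ * (φ (C (c k)) * _) = _
      ring
  obtain ⟨r, hr⟩ := minpoly.mem_range_of_degree_eq_one ℂ ρ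
    (IsAlgClosed.degree_eq_one_of_irreducible ℂ (minpoly.irreducible hρℂ.isIntegral))
  refine ⟨r, (hφ0 _).mp ?_⟩
  have hr : φ (C r) = φ a / φ p := hr
  rw [map_sub, map_mul, hr, div_mul_cancel₀ _ hφp, sub_self]

theorem exists_dvd_sub_C_mul_of_mem_ruppertGaoSpace {n : ℕ}
    {P q : MvPolynomial (Fin (n + 1)) ℂ} {A : Fin (n + 1) → MvPolynomial (Fin (n + 1)) ℂ}
    (hA : A ∈ ruppertGaoSpace (n + 1) P) (hq : Prime q) (hdeg : degreeOf 0 q ≠ 0) (hqP : q ∣ P)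
    (hp : ¬ q ∣ pderiv 0 P) : ∃ c : ℂ, q ∣ A 0 - C c * pderiv 0 P := by
  refine exists_dvd_sub_C_mul_of_derivation hq hdeg hp
    (fun i => pderiv 0 P • pderiv i.succ - pderiv i.succ P • pderiv 0) (fun i => ?_)
    (fun i f => ?_) fun i => ?_
  · obtain ⟨H, rfl⟩ := hqP
    refine ⟨pderiv 0 H * pderiv i.succ q - pderiv i.succ H * pderiv 0 q, ?_⟩
    simp only [Derivation.sub_apply, Derivation.smul_apply, smul_eq_mul, pderiv_mul]
    ring
  · have h0 : pderiv 0 (rename (Fin.succ : Fin n → Fin (n + 1)) f) = 0 := by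
      refine pderiv_eq_zero_of_notMem_vars fun h0 => ?_
      classical simpa using vars_rename _ _ h0
    simp [h0, pderiv_rename (Fin.succ_injective n)]
  · have h := hA.1 0 i.succ (Fin.succ_pos i)
    have h' := congrArg (pderiv 0) h
    simp only [pderiv_mul, map_sub] at h'
    refine hqP.trans ⟨pderiv 0 P * (pderiv 0 (pderiv 0 (A i.succ)) -
      pderiv 0 (pderiv i.succ (A 0))) - pderiv 0 (pderiv 0 P) *
      (pderiv 0 (A i.succ) - pderiv i.succ (A 0)), ?_⟩
    simp only [Derivation.sub_apply, Derivation.smul_apply, smul_eq_mul, pderiv_comm i.succ 0 P]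
    linear_combination pderiv 0 (pderiv 0 P) * h - pderiv 0 P * h'

theorem mem_ruppertGaoSpace_mul_pderiv {n : ℕ} {H q : MvPolynomial (Fin n) ℂ}
    (hH : H ≠ 0) (hq : q ≠ 0) : (fun i => H * pderiv i q) ∈ ruppertGaoSpace n (H * q) := by
  refine ⟨fun i j _ => ?_, fun i => ?_, fun i j _ => ?_⟩
  · simp only [pderiv_mul, pderiv_comm i j q]
    ring
  · rw [degreeOf_mul_eq hH hq]
    by_cases h0 : degreeOf i q = 0
    · simp [pderiv_eq_zero_of_degreeOf_eq_zero h0]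
    · have h1 := degreeOf_mul_le i H (pderiv i q)
      have h2 := degreeOf_pderiv_self_le i q
      dsimp only
      omega
  · rw [degreeOf_mul_eq hH hq]
    exact (degreeOf_mul_le _ _ _).trans (Nat.add_le_add_left (degreeOf_pderiv_le_s11 i j q) _)

/-- for a reduced (squarefree) `X_1`-generic polynomial
`P = P_1 ⋯ P_s ∈ ℂ[X_1,…,X_{n+1}]` with distinct irreducible factors, the
residue classes of `C^j_1 = B^j_1·∂P/∂X_1` in `Q(P) = ℂ[X_1,…,X_{n+1}]/(P)` are
linearly independent over `ℂ`; in particular the subspace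
`Ẽ(P) = {[v·∂P/∂X_1] : v ∈ E(P)}` of `Q(P)` has dimension `s`. -/
theorem linearIndependent_C_classes_and_dim_Etilde
    (n : ℕ) (P : MvPolynomial (Fin (n + 1)) ℂ) (s : ℕ)
    (Q : Fin s → MvPolynomial (Fin (n + 1)) ℂ)
    (hfac : P = ∏ i, Q i) (hirr : ∀ i, Irreducible (Q i))
    (hdist : ∀ i j, i ≠ j → ¬ Associated (Q i) (Q j))
    (hgen : IsX1Generic n P)
    (B : Fin s → MvPolynomial (Fin (n + 1)) ℂ)
    (hB : ∀ j, B j = (∏ k ∈ Finset.univ.erase j, Q k) * pderiv 0 (Q j)) :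
    LinearIndependent ℂ
        (fun j => Ideal.Quotient.mk (Ideal.span {P}) (B j * pderiv 0 P)) ∧
      Module.finrank ℂ
        (Submodule.map ((Ideal.Quotient.mkₐ ℂ (Ideal.span {P})).toLinearMap ∘ₗ
            LinearMap.mulRight ℂ (pderiv 0 P))
          (Submodule.map (LinearMap.proj 0) (ruppertGaoSpace (n + 1) P))) = s := by
  have hprime (j) : Prime (Q j) := (hirr j).prime
  have hPQ (j) : P = (∏ k ∈ Finset.univ.erase j, Q k) * Q j := by
    rw [hfac, Finset.prod_erase_mul _ _ (Finset.mem_univ j)]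
  have hdvd (j) : Q j ∣ P := ⟨_, (hPQ j).trans (mul_comm _ _)⟩
  have hndvd (j) : ¬ Q j ∣ ∏ k ∈ Finset.univ.erase j, Q k := by
    rw [(hprime j).dvd_finsetProd_iff]
    rintro ⟨k, hk, h⟩
    exact hdist j k (Finset.ne_of_mem_erase hk).symm
      ((hprime j).associated_of_dvd (hprime k) h)
  have hdeg (j) : degreeOf 0 (Q j) ≠ 0 := hgen.degreeOf_ne_zero (hirr j).not_isUnit (hdvd j)
  have hBself (j) : Q j ∣ pderiv 0 P - B j := by
    refine ⟨pderiv 0 (∏ k ∈ Finset.univ.erase j, Q k), ?_⟩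
    rw [hB, hPQ j, pderiv_mul]
    ring
  have hBne (j k) (hjk : k ≠ j) : Q j ∣ B k := by
    rw [hB]
    exact (Finset.dvd_prod_of_mem Q
      (Finset.mem_erase.mpr ⟨hjk.symm, Finset.mem_univ j⟩)).mul_right _
  have hP₁ (j) : ¬ Q j ∣ pderiv 0 P := fun h => by
    have hBj : Q j ∣ B j := by simpa using h.sub (hBself j)
    rw [hB] at hBj
    exact ((hprime j).dvd_or_dvd hBj).elim (hndvd j) (not_dvd_pderiv_zero (hdeg j))
  have hsum (c : Fin s → ℂ) (j) : Q j ∣ (∑ k, C (c k) * B k) - C (c j) * pderiv 0 P := by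
    rw [← Finset.add_sum_erase _ _ (Finset.mem_univ j)]
    have h1 : Q j ∣ ∑ k ∈ Finset.univ.erase j, C (c k) * B k :=
      Finset.dvd_sum fun k hk => (hBne j k (Finset.ne_of_mem_erase hk)).mul_left _
    convert h1.sub ((hBself j).mul_left (C (c j))) using 1
    ring
  have hmk (c : Fin s → ℂ) :
      ∑ j, c j • Ideal.Quotient.mk (Ideal.span {P}) (B j * pderiv 0 P) =
        Ideal.Quotient.mk (Ideal.span {P}) ((∑ k, C (c k) * B k) * pderiv 0 P) := by
    rw [Finset.sum_mul, map_sum]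
    refine Finset.sum_congr rfl fun j _ => ?_
    rw [mul_assoc, ← smul_eq_C_mul]
    exact (map_smul (Ideal.Quotient.mkₐ ℂ (Ideal.span {P})) _ _).symm
  have hli : LinearIndependent ℂ
      (fun j => Ideal.Quotient.mk (Ideal.span {P}) (B j * pderiv 0 P)) := by
    rw [Fintype.linearIndependent_iff]
    intro c hc j
    rw [hmk, Ideal.Quotient.eq_zero_iff_mem, Ideal.mem_span_singleton] at hc
    have h := ((hprime j).dvd_or_dvd ((hdvd j).trans hc)).resolve_right (hP₁ j)
    have h' : Q j ∣ C (c j) * pderiv 0 P := by simpa using h.sub (hsum c j)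
    have h'' := ((hprime j).dvd_or_dvd h').resolve_right (hP₁ j)
    by_contra hcj
    exact (hprime j).not_isUnit (isUnit_of_dvd_unit h'' ((isUnit_iff_ne_zero.mpr hcj).map C))
  refine ⟨hli, ?_⟩
  suffices hspan : Submodule.map ((Ideal.Quotient.mkₐ ℂ (Ideal.span {P})).toLinearMap ∘ₗ
        LinearMap.mulRight ℂ (pderiv 0 P))
        (Submodule.map (LinearMap.proj 0) (ruppertGaoSpace (n + 1) P)) =
      Submodule.span ℂ (Set.range
        fun j => Ideal.Quotient.mk (Ideal.span {P}) (B j * pderiv 0 P)) by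
    rw [hspan, finrank_span_eq_card hli, Fintype.card_fin]
  apply le_antisymm
  · rintro _ ⟨_, ⟨A, hA, rfl⟩, rfl⟩
    choose c hc using fun j => exists_dvd_sub_C_mul_of_mem_ruppertGaoSpace hA (hprime j)
      (hdeg j) (hdvd j) (hP₁ j)
    have hAc : P ∣ A 0 - ∑ k, C (c k) * B k := by
      rw [hfac]
      refine Finset.prod_dvd_of_isRelPrime (fun i _ j _ hij => ?_) fun j _ => ?_
      · exact ((hirr i).isRelPrime_iff_not_dvd).mpr fun h =>
          hdist i j hij ((hprime i).associated_of_dvd (hprime j) h)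
      · simpa using (hc j).sub (hsum c j)
    have hmem : ∑ j, c j • Ideal.Quotient.mk (Ideal.span {P}) (B j * pderiv 0 P) ∈
        Submodule.span ℂ (Set.range
          fun j => Ideal.Quotient.mk (Ideal.span {P}) (B j * pderiv 0 P)) :=
      Submodule.sum_mem _ fun j _ =>
        Submodule.smul_mem _ _ (Submodule.subset_span (Set.mem_range_self j))
    rw [hmk] at hmem
    convert hmem using 1
    refine Ideal.Quotient.eq.mpr (Ideal.mem_span_singleton.mpr ?_)
    simpa [sub_mul] using hAc.mul_right (pderiv 0 P)
  · rw [Submodule.span_le]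
    rintro _ ⟨j, rfl⟩
    refine ⟨B j, ⟨fun i => (∏ k ∈ Finset.univ.erase j, Q k) * pderiv i (Q j), ?_, (hB j).symm⟩,
      rfl⟩
    rw [hPQ j]
    exact mem_ruppertGaoSpace_mul_pderiv
      (Finset.prod_ne_zero_iff.mpr fun k _ => (hprime k).ne_zero) (hprime j).ne_zero
end
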